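/- arXiv:2107.01227 — 3 statements merged into one kernel-verified Lean document; each statement's English description precedes it below -/
import Mathlib

section
/- Let 𝒢 be an ultragraph and E_𝒢 the directed graph associated to 𝒢. Then 𝒢 satisfies Condition (Y) if and only if E_𝒢 satisfies Condition (Y). -/
/-- An ultragraph: a source map `src : E → V` and a range map assigning to each
edge a nonempty set of vertices. -/
structure Ultragraph (V : Type) (E : Type) : Type where
  src : E → V
  rng : E → Set V
  rng_nonempty : ∀ e, (rng e).Nonempty

namespace Ultragraph

variable {V E : Type}

/-- A finite path: a (possibly empty) list of edges with compatible transitions. -/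
def IsPath (G : Ultragraph V E) (es : List E) : Prop :=
  es.Chain' fun e f => G.src f ∈ G.rng e

/-- An infinite path. -/
def IsInfinitePath (G : Ultragraph V E) (p : ℕ → E) : Prop :=
  ∀ i : ℕ, G.src (p (i + 1)) ∈ G.rng (p i)

/-- Condition (Y). -/
def ConditionY (G : Ultragraph V E) : Prop :=
  ∀ p : ℕ → E, G.IsInfinitePath p →
    ∃ (k : ℕ) (α : List E) (hα : α ≠ []),
      α.length = k + 1 ∧ G.IsPath α ∧ G.src (p k) ∈ G.rng (α.getLast hα)

/-- The collection 𝒢⁰ of generalized vertices: the smallest collection of subsets of `V`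
containing the singletons and the ranges of edges, closed under finite unions and finite
intersections (the empty set is included for convenience; `p_∅ = 0`). -/
inductive InG0 (G : Ultragraph V E) : Set V → Prop
  | vertex (v : V) : InG0 G {v}
  | range (e : E) : InG0 G (G.rng e)
  | union {A B : Set V} : InG0 G A → InG0 G B → InG0 G (A ∪ B)
  | inter {A B : Set V} : InG0 G A → InG0 G B → InG0 G (A ∩ B)

/-- Generators of the Leavitt path algebra. -/
inductive LPAGen (G : Ultragraph V E) : Type
  | edge : E → LPAGen G
  | star : E → LPAGen G
  | proj : (A : Set V) → G.InG0 A → LPAGen G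

/-- The directed graph `E_𝒢` associated to an ultragraph, viewed again as an ultragraph
whose edge ranges are singletons. -/
def toGraph (G : Ultragraph V E) : Ultragraph V {q : E × V // q.2 ∈ G.rng q.1} where
  src q := G.src q.1.1
  rng q := {q.1.2}
  rng_nonempty q := ⟨q.1.2, rfl⟩

variable (R : Type) [CommRing R] (G : Ultragraph V E)

/-- The free `R`-algebra on the generators. -/
abbrev FA := FreeAlgebra R (LPAGen G)

/-- The generator `g` inside the free algebra. -/
def X (g : LPAGen G) : FA R G := FreeAlgebra.ι R g

/-- The defining relations of the Leavitt path algebra of an ultragraph. -/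
inductive LeavittRel : FA R G → FA R G → Prop
  | proj_empty (h : G.InG0 ∅) : LeavittRel (X R G (.proj ∅ h)) 0
  | proj_mul (A B : Set V) (hA : G.InG0 A) (hB : G.InG0 B) :
      LeavittRel (X R G (.proj A hA) * X R G (.proj B hB))
        (X R G (.proj (A ∩ B) (hA.inter hB)))
  | proj_union (A B : Set V) (hA : G.InG0 A) (hB : G.InG0 B) :
      LeavittRel (X R G (.proj (A ∪ B) (hA.union hB)))
        (X R G (.proj A hA) + X R G (.proj B hB) - X R G (.proj (A ∩ B) (hA.inter hB)))
  | src_mul (e : E) :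
      LeavittRel (X R G (.proj {G.src e} (InG0.vertex (G.src e))) * X R G (.edge e))
        (X R G (.edge e))
  | mul_rng (e : E) :
      LeavittRel (X R G (.edge e) * X R G (.proj (G.rng e) (InG0.range e)))
        (X R G (.edge e))
  | rng_mul_star (e : E) :
      LeavittRel (X R G (.proj (G.rng e) (InG0.range e)) * X R G (.star e))
        (X R G (.star e))
  | star_mul_src (e : E) :
      LeavittRel (X R G (.star e) * X R G (.proj {G.src e} (InG0.vertex (G.src e))))
        (X R G (.star e))
  | star_mul_same (e : E) :
      LeavittRel (X R G (.star e) * X R G (.edge e))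
        (X R G (.proj (G.rng e) (InG0.range e)))
  | star_mul_ne (e f : E) (h : e ≠ f) :
      LeavittRel (X R G (.star e) * X R G (.edge f)) 0
  | ck (v : V) (hfin : {e : E | G.src e = v}.Finite) (hne : {e : E | G.src e = v}.Nonempty) :
      LeavittRel (X R G (.proj {v} (InG0.vertex v)))
        (∑ e ∈ hfin.toFinset, X R G (.edge e) * X R G (.star e))

/-- The (unital) quotient of the free algebra by the Leavitt relations; the Leavitt
path algebra `L_R(𝒢)` sits inside it as the non-unital subalgebra generated by the
generators. -/
abbrev LPABig := RingQuot (LeavittRel R G)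

/-- The image of a generator in the quotient. -/
def gen (g : LPAGen G) : LPABig R G := RingQuot.mkAlgHom R (LeavittRel R G) (X R G g)

/-- `s_e`. -/
def sgen (e : E) : LPABig R G := gen R G (.edge e)

/-- `s_e^*`. -/
def tgen (e : E) : LPABig R G := gen R G (.star e)

/-- `p_A`. -/
def pgen (A : Set V) (hA : G.InG0 A) : LPABig R G := gen R G (.proj A hA)

/-- `s_α` for a finite path `α` (the empty product is `1` in the ambient algebra). -/
def sPath (es : List E) : LPABig R G := (es.map (sgen R G)).prod

/-- `s_β^*` for a finite path `β`. -/
def tPath (es : List E) : LPABig R G := (es.reverse.map (tgen R G)).prod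

/-- The monomial `s_α p_A s_β^*`. -/
def mono (α : List E) (A : Set V) (hA : G.InG0 A) (β : List E) : LPABig R G :=
  sPath R G α * pgen R G A hA * tPath R G β

/-- The `m`-th component of the canonical `ℤ`-grading: all finite `R`-linear combinations
of monomials `s_α p_A s_β^*` with `|α| - |β| = m`. -/
def zComp (m : ℤ) : AddSubgroup (LPABig R G) :=
  AddSubgroup.closure {x | ∃ (l : R) (α β : List E) (A : Set V) (hA : G.InG0 A),
    G.IsPath α ∧ G.IsPath β ∧ (α.length : ℤ) - (β.length : ℤ) = m ∧
    x = l • mono R G α A hA β}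

/-- The element of the free group on the edges determined by a finite path. -/
def pathWord (es : List E) : FreeGroup E := (es.map FreeGroup.of).prod

/-- The `g`-th component of the free-group grading: all finite `R`-linear combinations
of monomials `s_α p_A s_β^*` with `α β⁻¹ = g` in the free group on the edges. -/
def fComp (g : FreeGroup E) : AddSubgroup (LPABig R G) :=
  AddSubgroup.closure {x | ∃ (l : R) (α β : List E) (A : Set V) (hA : G.InG0 A),
    G.IsPath α ∧ G.IsPath β ∧ pathWord α * (pathWord β)⁻¹ = g ∧
    x = l • mono R G α A hA β}

/-- The set of generators inside the quotient. -/
def genSet : Set (LPABig R G) := Set.range (gen R G)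

/-- The Leavitt path algebra `L_R(𝒢)`: the non-unital subalgebra of the quotient
generated by the images of the generators. -/
def LPA : NonUnitalSubalgebra R (LPABig R G) := NonUnitalAlgebra.adjoin R (genSet R G)

/-- `s_e` as an element of `L_R(𝒢)`. -/
def sEl (e : E) : LPA R G :=
  ⟨sgen R G e, NonUnitalAlgebra.subset_adjoin R ⟨LPAGen.edge e, rfl⟩⟩

/-- `s_e^*` as an element of `L_R(𝒢)`. -/
def tEl (e : E) : LPA R G :=
  ⟨tgen R G e, NonUnitalAlgebra.subset_adjoin R ⟨LPAGen.star e, rfl⟩⟩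

/-- `p_A` as an element of `L_R(𝒢)`. -/
def pEl (A : Set V) (hA : G.InG0 A) : LPA R G :=
  ⟨pgen R G A hA, NonUnitalAlgebra.subset_adjoin R ⟨LPAGen.proj A hA, rfl⟩⟩

end Ultragraph

/-- The additive span of the set of products `{a b : a ∈ S, b ∈ T}`. -/
def mulSpan {A : Type} [AddGroup A] [Mul A] (S T : AddSubgroup A) : AddSubgroup A :=
  AddSubgroup.closure {x | ∃ a ∈ S, ∃ b ∈ T, x = a * b}

namespace Ultragraph

/-- Edges of `E_𝒢` that are composable in `E_𝒢` are composable in `𝒢`. -/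
theorem src_mem_rng_of_toGraph {V E : Type} {G : Ultragraph V E}
    {a b : {q : E × V // q.2 ∈ G.rng q.1}} (h : G.toGraph.src b ∈ G.toGraph.rng a) :
    G.src b.1.1 ∈ G.rng a.1.1 := by
  have h' : G.src b.1.1 = a.1.2 := h
  exact h' ▸ a.2

/-- A finite path of `E_𝒢` projects to a finite path of `𝒢`. -/
theorem IsPath.map_toGraph {V E : Type} {G : Ultragraph V E}
    {β : List {q : E × V // q.2 ∈ G.rng q.1}} (h : G.toGraph.IsPath β) :
    G.IsPath (β.map fun q => q.1.1) :=
  (List.isChain_map _).2 (List.IsChain.imp (fun _ _ => src_mem_rng_of_toGraph) h)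

/-- A finite path of `𝒢` together with a vertex in its range lifts to a finite path of `E_𝒢`
ending at that vertex. -/
theorem IsPath.exists_toGraph {V E : Type} {G : Ultragraph V E} {v : V} :
    ∀ {α : List E} (hα : α ≠ []), G.IsPath α → v ∈ G.rng (α.getLast hα) →
      ∃ (β : List {q : E × V // q.2 ∈ G.rng q.1}) (hβ : β ≠ []),
        (β.map fun q => q.1.1) = α ∧ G.toGraph.IsPath β ∧ v ∈ G.toGraph.rng (β.getLast hβ)
  | [], hα, _, _ => absurd rfl hα
  | [e], _, _, hv =>
    ⟨[⟨(e, v), hv⟩], List.cons_ne_nil _ _, rfl, List.isChain_singleton _, rfl⟩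
  | e :: f :: t, _, h, hv => by
    obtain ⟨hef, ht⟩ := List.isChain_cons_cons.1 h
    obtain ⟨β, hβ, hmap, hpath, hlast⟩ :=
      IsPath.exists_toGraph (List.cons_ne_nil f t) ht (by simpa using hv)
    obtain ⟨b, bs, rfl⟩ := List.exists_cons_of_ne_nil hβ
    have hb : b.1.1 = f := (List.cons.inj hmap).1
    refine ⟨⟨(e, G.src f), hef⟩ :: b :: bs, List.cons_ne_nil _ _, by rw [List.map_cons, hmap],
      List.isChain_cons_cons.2 ⟨congrArg G.src hb, hpath⟩, ?_⟩
    rwa [List.getLast_cons hβ]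

end Ultragraph

open Ultragraph in
/-- `𝒢` satisfies Condition (Y) iff the associated directed graph `E_𝒢`
satisfies Condition (Y). -/
theorem conditionY_iff_toGraph {V E : Type} [Countable V] [Countable E]
    (G : Ultragraph V E) :
    G.ConditionY ↔ G.toGraph.ConditionY := by
  constructor
  · intro hY p hp
    obtain ⟨k, α, hα, hlen, hpath, hlast⟩ :=
      hY (fun i => (p i).1.1) fun i => src_mem_rng_of_toGraph (hp i)
    obtain ⟨β, hβ, rfl, hβpath, hβlast⟩ := hpath.exists_toGraph hα hlast
    exact ⟨k, β, hβ, by simpa using hlen, hβpath, hβlast⟩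
  · intro hY p hp
    obtain ⟨k, β, hβ, hlen, hpath, hlast⟩ :=
      hY (fun i => ⟨(p i, G.src (p (i + 1))), hp i⟩) fun _ => rfl
    refine ⟨k, β.map fun q => q.1.1, by simpa using hβ, by simpa using hlen,
      hpath.map_toGraph, ?_⟩
    rw [List.getLast_map]
    exact src_mem_rng_of_toGraph hlast
end

section
/- Let G be a group with identity element 1 and let T be a (not necessarily unital) associative ring graded by G. If for every g ∈ G there exists an element ε_g in the additive span T_g T_{g⁻¹} such that ε_g t = t = t ε_{g⁻¹} for all t ∈ T_g, then T is a unital ring with multiplicative identity ε_1. -/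
theorem mulSpan_le {A : Type} [AddGroup A] [Mul A] {S T U : AddSubgroup A}
    (h : ∀ a ∈ S, ∀ b ∈ T, a * b ∈ U) : mulSpan S T ≤ U :=
  (AddSubgroup.closure_le U).2 fun _ ⟨a, ha, b, hb, hx⟩ => hx ▸ h a ha b hb

/-- an epsilon-strongly `G`-graded ring is unital, with unit `ε₁`. -/
theorem unital_of_epsilon_strong {G : Type} [Group G] [DecidableEq G]
    {T : Type} [NonUnitalRing T]
    (comp : G → AddSubgroup T)
    (hmul : ∀ (g h : G) (a b : T), a ∈ comp g → b ∈ comp h → a * b ∈ comp (g * h))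
    (hinternal : DirectSum.IsInternal comp)
    (eps : G → T)
    (heps : ∀ g : G, eps g ∈ mulSpan (comp g) (comp g⁻¹))
    (hid : ∀ g : G, ∀ t ∈ comp g, eps g * t = t ∧ t * eps g⁻¹ = t) :
    ∀ x : T, eps 1 * x = x ∧ x * eps 1 = x := by
  have heps_one : ∀ g, eps g ∈ comp 1 := fun g =>
    mulSpan_le (fun a ha b hb => mul_inv_cancel g ▸ hmul g g⁻¹ a b ha hb) (heps g)
  have hleft : ∀ g, ∀ t ∈ comp g, eps 1 * t = t := fun g t ht => by
    rw [← (hid g t ht).1, ← mul_assoc, (hid 1 _ (heps_one g)).1]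
  have hright : ∀ g, ∀ t ∈ comp g, t * eps 1 = t := fun g t ht => by
    have h := (hid 1 _ (heps_one g⁻¹)).2
    rw [inv_one] at h
    rw [← (hid g t ht).2, mul_assoc, h]
  intro x
  obtain ⟨y, rfl⟩ := hinternal.surjective x
  induction y using DirectSum.induction_on with
  | zero => simp
  | of g t =>
    rw [DirectSum.coeAddMonoidHom_of]
    exact ⟨hleft g t t.2, hright g t t.2⟩
  | add y z hy hz => simp only [map_add, mul_add, add_mul, hy, hz, and_self]
end

section
/- Let 𝒢 be an ultragraph and R a nonzero unital commutative ring. Then L_R(𝒢) is strongly ℤ-graded with respect to the canonical grading {L_R(𝒢)_n}_{n∈ℤ} if and only if no vertex of 𝒢 is a sink, 𝒢 is row-finite, and 𝒢 satisfies Condition (Y). -/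
namespace Ultragraph

section Relations

variable {V E : Type} (R : Type) [CommRing R] (G : Ultragraph V E)

lemma pgen_congr {A B : Set V} (h : A = B) (hA : G.InG0 A) (hB : G.InG0 B) :
    pgen R G A hA = pgen R G B hB := by
  subst h; rfl

lemma pgen_empty {A : Set V} (h : A = ∅) (hA : G.InG0 A) : pgen R G A hA = 0 := by
  subst h
  simpa [pgen, gen] using RingQuot.mkAlgHom_rel R (LeavittRel.proj_empty (R := R) hA)

lemma pgen_mul {A B : Set V} (hA : G.InG0 A) (hB : G.InG0 B) :
    pgen R G A hA * pgen R G B hB = pgen R G (A ∩ B) (hA.inter hB) := by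
  simpa [pgen, gen] using RingQuot.mkAlgHom_rel R (LeavittRel.proj_mul (R := R) A B hA hB)

lemma pgen_union {A B : Set V} (hA : G.InG0 A) (hB : G.InG0 B) :
    pgen R G (A ∪ B) (hA.union hB) =
      pgen R G A hA + pgen R G B hB - pgen R G (A ∩ B) (hA.inter hB) := by
  simpa [pgen, gen] using RingQuot.mkAlgHom_rel R (LeavittRel.proj_union (R := R) A B hA hB)

/-- `p_v` for a vertex `v`. -/
def pvert (v : V) : LPABig R G := pgen R G {v} (.vertex v)

lemma pvert_mul_sgen (e : E) : pvert R G (G.src e) * sgen R G e = sgen R G e := by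
  simpa [pvert, sgen, pgen, gen] using RingQuot.mkAlgHom_rel R (LeavittRel.src_mul (R := R) e)

lemma sgen_mul_rng (e : E) : sgen R G e * pgen R G (G.rng e) (.range e) = sgen R G e := by
  simpa [sgen, pgen, gen] using RingQuot.mkAlgHom_rel R (LeavittRel.mul_rng (R := R) e)

lemma rng_mul_tgen (e : E) : pgen R G (G.rng e) (.range e) * tgen R G e = tgen R G e := by
  simpa [tgen, pgen, gen] using RingQuot.mkAlgHom_rel R (LeavittRel.rng_mul_star (R := R) e)

lemma tgen_mul_pvert (e : E) : tgen R G e * pvert R G (G.src e) = tgen R G e := by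
  simpa [pvert, tgen, pgen, gen] using
    RingQuot.mkAlgHom_rel R (LeavittRel.star_mul_src (R := R) e)

lemma tgen_mul_sgen_self (e : E) : tgen R G e * sgen R G e = pgen R G (G.rng e) (.range e) := by
  simpa [sgen, tgen, pgen, gen] using
    RingQuot.mkAlgHom_rel R (LeavittRel.star_mul_same (R := R) e)

lemma tgen_mul_sgen_ne {e f : E} (h : e ≠ f) : tgen R G e * sgen R G f = 0 := by
  simpa [sgen, tgen, gen] using
    RingQuot.mkAlgHom_rel R (LeavittRel.star_mul_ne (R := R) (G := G) e f h)

lemma pvert_eq_sum (v : V) (hfin : {e : E | G.src e = v}.Finite)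
    (hne : {e : E | G.src e = v}.Nonempty) :
    pvert R G v = ∑ e ∈ hfin.toFinset, sgen R G e * tgen R G e := by
  simpa [pvert, sgen, tgen, pgen, gen] using
    RingQuot.mkAlgHom_rel R (LeavittRel.ck (R := R) v hfin hne)

variable {G}

lemma pvert_mul_pgen_of_mem {v : V} {A : Set V} (hA : G.InG0 A) (h : v ∈ A) :
    pvert R G v * pgen R G A hA = pvert R G v := by
  rw [pvert, pgen_mul]
  exact pgen_congr R G (by simpa using h) _ _

lemma pvert_mul_pgen_of_notMem {v : V} {A : Set V} (hA : G.InG0 A) (h : v ∉ A) :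
    pvert R G v * pgen R G A hA = 0 := by
  rw [pvert, pgen_mul]
  exact pgen_empty R G (by simpa using h) _

lemma pgen_mul_pvert {v : V} {A : Set V} (hA : G.InG0 A) :
    pgen R G A hA * pvert R G v = pvert R G v * pgen R G A hA := by
  rw [pvert, pgen_mul, pgen_mul]
  exact pgen_congr R G (Set.inter_comm _ _) _ _

lemma pvert_mul_self (v : V) : pvert R G v * pvert R G v = pvert R G v :=
  pvert_mul_pgen_of_mem R _ rfl

lemma pgen_mul_self {A : Set V} (hA : G.InG0 A) :
    pgen R G A hA * pgen R G A hA = pgen R G A hA := by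
  rw [pgen_mul]
  exact pgen_congr R G (Set.inter_self A) _ _

lemma pgen_mul_sgen_of_mem {A : Set V} (hA : G.InG0 A) {e : E} (h : G.src e ∈ A) :
    pgen R G A hA * sgen R G e = sgen R G e := by
  rw [← pvert_mul_sgen, ← mul_assoc, pgen_mul_pvert, pvert_mul_pgen_of_mem R hA h]

lemma pgen_mul_sgen_of_notMem {A : Set V} (hA : G.InG0 A) {e : E} (h : G.src e ∉ A) :
    pgen R G A hA * sgen R G e = 0 := by
  rw [← pvert_mul_sgen, ← mul_assoc, pgen_mul_pvert, pvert_mul_pgen_of_notMem R hA h, zero_mul]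

lemma tgen_mul_pgen_of_mem {A : Set V} (hA : G.InG0 A) {e : E} (h : G.src e ∈ A) :
    tgen R G e * pgen R G A hA = tgen R G e := by
  rw [← tgen_mul_pvert, mul_assoc, pvert_mul_pgen_of_mem R hA h]

lemma tgen_mul_pgen_of_notMem {A : Set V} (hA : G.InG0 A) {e : E} (h : G.src e ∉ A) :
    tgen R G e * pgen R G A hA = 0 := by
  rw [← tgen_mul_pvert, mul_assoc, pvert_mul_pgen_of_notMem R hA h, mul_zero]

lemma sgen_mul_sgen_eq_zero {e f : E} (h : G.src f ∉ G.rng e) :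
    sgen R G e * sgen R G f = 0 := by
  rw [← sgen_mul_rng, mul_assoc, pgen_mul_sgen_of_notMem R _ h, mul_zero]

lemma tgen_mul_tgen_eq_zero {e f : E} (h : G.src f ∉ G.rng e) :
    tgen R G f * tgen R G e = 0 := by
  rw [← rng_mul_tgen R G e, ← mul_assoc, tgen_mul_pgen_of_notMem R _ h, zero_mul]

/-! ### Words in the edges -/

variable (G)

@[simp] lemma sPath_nil : sPath R G [] = 1 := by simp [sPath]

@[simp] lemma sPath_cons (a : E) (l : List E) :
    sPath R G (a :: l) = sgen R G a * sPath R G l := by simp [sPath]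

@[simp] lemma sPath_append (l l' : List E) :
    sPath R G (l ++ l') = sPath R G l * sPath R G l' := by simp [sPath]

@[simp] lemma tPath_nil : tPath R G [] = 1 := by simp [tPath]

@[simp] lemma tPath_cons (a : E) (l : List E) :
    tPath R G (a :: l) = tPath R G l * tgen R G a := by simp [tPath]

@[simp] lemma tPath_append (l l' : List E) :
    tPath R G (l ++ l') = tPath R G l' * tPath R G l := by simp [tPath]

variable {G}

lemma isPath_cons_cons {a b : E} {l : List E} :
    G.IsPath (a :: b :: l) ↔ G.src b ∈ G.rng a ∧ G.IsPath (b :: l) :=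
  List.isChain_cons_cons

lemma sPath_eq_zero {l : List E} (h : ¬ G.IsPath l) : sPath R G l = 0 := by
  induction l with
  | nil => exact absurd List.isChain_nil h
  | cons a l ih =>
    cases l with
    | nil => exact absurd (List.isChain_singleton a) h
    | cons b l =>
      by_cases hb : G.src b ∈ G.rng a
      · rw [sPath_cons, ih (fun h' => h (isPath_cons_cons.2 ⟨hb, h'⟩)), mul_zero]
      · rw [sPath_cons, sPath_cons, ← mul_assoc, sgen_mul_sgen_eq_zero R hb, zero_mul]

lemma tPath_eq_zero {l : List E} (h : ¬ G.IsPath l) : tPath R G l = 0 := by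
  induction l with
  | nil => exact absurd List.isChain_nil h
  | cons a l ih =>
    cases l with
    | nil => exact absurd (List.isChain_singleton a) h
    | cons b l =>
      by_cases hb : G.src b ∈ G.rng a
      · rw [tPath_cons, ih (fun h' => h (isPath_cons_cons.2 ⟨hb, h'⟩)), zero_mul]
      · rw [tPath_cons, tPath_cons, mul_assoc, tgen_mul_tgen_eq_zero R hb, mul_zero]

lemma tPath_mul_sPath_self {l : List E} (hl : l ≠ []) (h : G.IsPath l) :
    tPath R G l * sPath R G l = pgen R G (G.rng (l.getLast hl)) (.range _) := by
  induction l with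
  | nil => exact absurd rfl hl
  | cons a l ih =>
    cases l with
    | nil => simp [tgen_mul_sgen_self]
    | cons b l =>
      rw [isPath_cons_cons] at h
      rw [List.getLast_cons (List.cons_ne_nil b l), ← ih (List.cons_ne_nil b l) h.2,
        tPath_cons _ _ a, sPath_cons _ _ a, mul_assoc, ← mul_assoc (tgen R G a),
        tgen_mul_sgen_self, sPath_cons, ← mul_assoc (pgen _ _ _ _), pgen_mul_sgen_of_mem R _ h.1]

/-- A path of positive length with range containing `w` gives a matrix-unit relation. -/
lemma pvert_mul_tPath_mul_sPath {l : List E} (hl : l ≠ []) (h : G.IsPath l) {w : V}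
    (hw : w ∈ G.rng (l.getLast hl)) :
    pvert R G w * tPath R G l * (sPath R G l * pvert R G w) = pvert R G w := by
  rw [mul_assoc, ← mul_assoc (tPath R G l), tPath_mul_sPath_self R hl h, ← mul_assoc,
    pvert_mul_pgen_of_mem R _ hw, pvert_mul_self]

/-- `p_w s_ξ^*` vanishes unless `ξ` is a path whose range contains `w`. -/
lemma pvert_mul_tPath_eq_zero {l : List E} (hl : l ≠ []) {w : V}
    (h : G.IsPath l → w ∉ G.rng (l.getLast hl)) : pvert R G w * tPath R G l = 0 := by
  by_cases hp : G.IsPath l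
  · have hw := h hp
    rw [← List.dropLast_append_getLast hl, tPath_append, tPath_cons, tPath_nil, one_mul,
      ← mul_assoc, ← rng_mul_tgen, ← mul_assoc, pvert_mul_pgen_of_notMem R _ hw, zero_mul, zero_mul]
  · rw [tPath_eq_zero R hp, mul_zero]

lemma pvert_mul_tPath_mul_pgen (w : V) (l : List E) {A : Set V} (hA : G.InG0 A) :
    pvert R G w * tPath R G l * pgen R G A hA = pvert R G w * tPath R G l ∨
      pvert R G w * tPath R G l * pgen R G A hA = 0 := by
  cases l with
  | nil =>
    by_cases h : w ∈ A
    · simp [pvert_mul_pgen_of_mem R hA h]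
    · simp [pvert_mul_pgen_of_notMem R hA h]
  | cons a l =>
    by_cases h : G.src a ∈ A
    · simp [mul_assoc, tgen_mul_pgen_of_mem R hA h]
    · simp [mul_assoc, tgen_mul_pgen_of_notMem R hA h]

lemma pvert_mul_tPath_mul_sPath_mul_eq_zero {w : V} {y : LPABig R G} (l m : List E)
    (hlm : l.length ≤ m.length)
    (hy : ∀ n : List E, n.length + l.length = m.length → pvert R G w * tPath R G n * y = 0) :
    pvert R G w * tPath R G m * (sPath R G l * y) = 0 := by
  induction l generalizing m with
  | nil => simpa using hy m (by simp)
  | cons a l ih =>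
    cases m with
    | nil => simp at hlm
    | cons b m =>
      have key := ih m (by simpa using hlm) (fun n hn => hy n (by simp [← hn, add_assoc]))
      by_cases hab : b = a
      · subst hab
        have hrw : pvert R G w * tPath R G (b :: m) * (sPath R G (b :: l) * y) =
            pvert R G w * tPath R G m * (tgen R G b * sgen R G b) * (sPath R G l * y) := by
          simp only [tPath_cons, sPath_cons, mul_assoc]
        rw [hrw, tgen_mul_sgen_self]
        rcases pvert_mul_tPath_mul_pgen R w m (InG0.range b) with h | h
        · rw [h, key]
        · rw [h, zero_mul]
      · have hrw : pvert R G w * tPath R G (b :: m) * (sPath R G (a :: l) * y) =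
            pvert R G w * tPath R G m * (tgen R G b * sgen R G a) * (sPath R G l * y) := by
          simp only [tPath_cons, sPath_cons, mul_assoc]
        rw [hrw, tgen_mul_sgen_ne R G hab, mul_zero, zero_mul]

end Relations

section Grading

variable {V E : Type} (R : Type) [CommRing R] (G : Ultragraph V E)

/-- The `m`-th homogeneous component as an `R`-submodule. -/
def comp (m : ℤ) : Submodule R (LPABig R G) :=
  Submodule.span R {x | ∃ (α β : List E) (A : Set V) (hA : G.InG0 A),
    (α.length : ℤ) - (β.length : ℤ) = m ∧ x = mono R G α A hA β}

variable {G}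

lemma mono_mem_comp {α β : List E} {A : Set V} {hA : G.InG0 A} {m : ℤ}
    (h : (α.length : ℤ) - (β.length : ℤ) = m) : mono R G α A hA β ∈ comp R G m :=
  Submodule.subset_span ⟨α, β, A, hA, h, rfl⟩

variable (G)

lemma zComp_eq (m : ℤ) : zComp R G m = (comp R G m).toAddSubgroup := by
  apply le_antisymm
  · rw [zComp, AddSubgroup.closure_le]
    rintro x ⟨l, α, β, A, hA, -, -, h, rfl⟩
    exact (comp R G m).smul_mem l (mono_mem_comp R h)
  · intro x hx
    have hx' : x ∈ comp R G m := hx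
    clear hx
    induction hx' using Submodule.span_induction with
    | mem x hx =>
      obtain ⟨α, β, A, hA, h, rfl⟩ := hx
      by_cases hα : G.IsPath α
      · by_cases hβ : G.IsPath β
        · exact AddSubgroup.subset_closure ⟨1, α, β, A, hA, hα, hβ, h, (one_smul _ _).symm⟩
        · rw [mono, tPath_eq_zero R hβ, mul_zero]
          exact zero_mem _
      · rw [mono, sPath_eq_zero R hα, zero_mul, zero_mul]
        exact zero_mem _
    | zero => exact zero_mem _
    | add x y _ _ hx hy => exact add_mem hx hy
    | smul a x hx' hx =>
      clear hx'
      induction hx using AddSubgroup.closure_induction with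
      | mem x hx =>
        obtain ⟨l, α, β, A, hA, hα, hβ, h, rfl⟩ := hx
        exact AddSubgroup.subset_closure ⟨a * l, α, β, A, hA, hα, hβ, h, (mul_smul _ _ _).symm⟩
      | zero => rw [smul_zero]; exact zero_mem _
      | add x y _ _ hx hy => rw [smul_add]; exact add_mem hx hy
      | neg x _ hx => rw [smul_neg]; exact neg_mem hx

lemma mulSpan_toAddSubgroup {B : Type} [Ring B] [Algebra R B] (M N : Submodule R B) :
    mulSpan M.toAddSubgroup N.toAddSubgroup = (M * N).toAddSubgroup := by
  apply le_antisymm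
  · rw [mulSpan, AddSubgroup.closure_le]
    rintro x ⟨a, ha, b, hb, rfl⟩
    exact Submodule.mul_mem_mul ha hb
  · intro x hx
    have hx' : x ∈ M * N := hx
    induction hx' using Submodule.mul_induction_on' with
    | mem_mul_mem a ha b hb => exact AddSubgroup.subset_closure ⟨a, ha, b, hb, rfl⟩
    | add x hx' y hy' ihx ihy => exact add_mem (ihx hx') (ihy hy')

lemma mulSpan_zComp_eq_iff (m n : ℤ) :
    mulSpan (zComp R G m) (zComp R G n) = zComp R G (m + n) ↔
      comp R G m * comp R G n = comp R G (m + n) := by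
  rw [zComp_eq, zComp_eq, zComp_eq, mulSpan_toAddSubgroup]
  exact Submodule.toAddSubgroup_injective.eq_iff

variable {G}

lemma mul_mem_comp_of_mono {a x : LPABig R G} {m n : ℤ} (hx : x ∈ comp R G m)
    (h : ∀ (α β : List E) (A : Set V) (hA : G.InG0 A), (α.length : ℤ) - (β.length : ℤ) = m →
      a * mono R G α A hA β ∈ comp R G n) : a * x ∈ comp R G n := by
  have hle : comp R G m ≤ (comp R G n).comap (LinearMap.mulLeft R a) := by
    rw [comp, Submodule.span_le]
    rintro x ⟨α, β, A, hA, hm, rfl⟩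
    exact h α β A hA hm
  exact hle hx

lemma sgen_mul_mem_comp (e : E) {x : LPABig R G} {m n : ℤ} (hx : x ∈ comp R G m)
    (hn : m + 1 = n) : sgen R G e * x ∈ comp R G n := by
  refine mul_mem_comp_of_mono R hx fun α β A hA hm => ?_
  have : sgen R G e * mono R G α A hA β = mono R G (e :: α) A hA β := by
    simp [mono, mul_assoc]
  rw [this]
  exact mono_mem_comp R (by push_cast [List.length_cons]; lia)

lemma pgen_mul_mem_comp {B : Set V} (hB : G.InG0 B) {x : LPABig R G} {m : ℤ}
    (hx : x ∈ comp R G m) : pgen R G B hB * x ∈ comp R G m := by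
  refine mul_mem_comp_of_mono R hx fun α β A hA hm => ?_
  cases α with
  | nil =>
    have : pgen R G B hB * mono R G [] A hA β = mono R G [] (B ∩ A) (hB.inter hA) β := by
      simp [mono, ← mul_assoc, pgen_mul]
    rw [this]
    exact mono_mem_comp R hm
  | cons a α =>
    by_cases ha : G.src a ∈ B
    · have : pgen R G B hB * mono R G (a :: α) A hA β = mono R G (a :: α) A hA β := by
        simp [mono, ← mul_assoc, pgen_mul_sgen_of_mem R hB ha]
      rw [this]
      exact mono_mem_comp R hm
    · have : pgen R G B hB * mono R G (a :: α) A hA β = 0 := by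
        simp [mono, ← mul_assoc, pgen_mul_sgen_of_notMem R hB ha]
      rw [this]
      exact zero_mem _

lemma tgen_mul_mem_comp (e : E) {x : LPABig R G} {m n : ℤ} (hx : x ∈ comp R G m)
    (hn : m - 1 = n) : tgen R G e * x ∈ comp R G n := by
  refine mul_mem_comp_of_mono R hx fun α β A hA hm => ?_
  cases α with
  | nil =>
    by_cases he : G.src e ∈ A
    · have : tgen R G e * mono R G [] A hA β =
          mono R G [] (G.rng e) (.range e) (β ++ [e]) := by
        simp [mono, ← mul_assoc, tgen_mul_pgen_of_mem R hA he, rng_mul_tgen]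
      rw [this]
      exact mono_mem_comp R (by
        simp only [List.length_nil, List.length_append, List.length_singleton] at hm ⊢
        push_cast; lia)
    · have : tgen R G e * mono R G [] A hA β = 0 := by
        simp [mono, ← mul_assoc, tgen_mul_pgen_of_notMem R hA he]
      rw [this]
      exact zero_mem _
  | cons a α =>
    by_cases hea : e = a
    · subst hea
      have : tgen R G e * mono R G (e :: α) A hA β =
          pgen R G (G.rng e) (.range e) * mono R G α A hA β := by
        simp [mono, ← mul_assoc, tgen_mul_sgen_self]
      rw [this]
      exact pgen_mul_mem_comp R _ (mono_mem_comp R (by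
        push_cast [List.length_cons] at hm; lia))
    · have : tgen R G e * mono R G (a :: α) A hA β = 0 := by
        simp [mono, ← mul_assoc, tgen_mul_sgen_ne R G hea]
      rw [this]
      exact zero_mem _

lemma tPath_mul_mem_comp (l : List E) {x : LPABig R G} {m n : ℤ} (hx : x ∈ comp R G m)
    (hn : m - l.length = n) : tPath R G l * x ∈ comp R G n := by
  induction l generalizing x m with
  | nil => simpa [← hn] using hx
  | cons a l ih =>
    rw [tPath_cons, mul_assoc]
    exact ih (tgen_mul_mem_comp R a hx rfl) (by push_cast [List.length_cons] at hn; lia)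

lemma sPath_mul_mem_comp (l : List E) {x : LPABig R G} {m n : ℤ} (hx : x ∈ comp R G m)
    (hn : m + l.length = n) : sPath R G l * x ∈ comp R G n := by
  induction l generalizing n with
  | nil => simpa [← hn] using hx
  | cons a l ih =>
    rw [sPath_cons, mul_assoc]
    exact sgen_mul_mem_comp R a (ih rfl) (by push_cast [List.length_cons] at hn; lia)

variable (G)

lemma comp_mul_comp_le (m n : ℤ) : comp R G m * comp R G n ≤ comp R G (m + n) := by
  rw [Submodule.mul_le]
  intro x hx y hy
  induction hx using Submodule.span_induction with
  | mem x hx =>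
    obtain ⟨α, β, A, hA, h, rfl⟩ := hx
    rw [mono, mul_assoc, mul_assoc]
    exact sPath_mul_mem_comp R α
      (pgen_mul_mem_comp R hA (tPath_mul_mem_comp R β hy rfl)) (by lia)
  | zero => rw [zero_mul]; exact zero_mem _
  | add x y _ _ hx hy => rw [add_mul]; exact add_mem hx hy
  | smul a x _ hx => rw [smul_mul_assoc]; exact Submodule.smul_mem _ _ hx

variable {G}

lemma pgen_mem_comp {A : Set V} (hA : G.InG0 A) : pgen R G A hA ∈ comp R G 0 := by
  have : pgen R G A hA = mono R G [] A hA [] := by simp [mono]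
  rw [this]
  exact mono_mem_comp R (by simp)

/-- Each monomial has a left local unit `p_C`. -/
lemma exists_pgen_mul_mono (α β : List E) {A : Set V} (hA : G.InG0 A) :
    ∃ (C : Set V) (hC : G.InG0 C),
      pgen R G C hC * mono R G α A hA β = mono R G α A hA β := by
  cases α with
  | nil => exact ⟨A, hA, by simp [mono, ← mul_assoc, pgen_mul_self]⟩
  | cons a α =>
    exact ⟨_, .vertex (G.src a), by
      simp [mono, ← mul_assoc, pgen_mul_sgen_of_mem R (.vertex (G.src a)) rfl]⟩

lemma comp_le_mul_comp {M : Submodule R (LPABig R G)}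
    (h : ∀ (A : Set V) (hA : G.InG0 A), pgen R G A hA ∈ M) (m : ℤ) :
    comp R G m ≤ M * comp R G m := by
  conv_lhs => rw [comp]
  rw [Submodule.span_le]
  rintro x ⟨α, β, A, hA, hm, rfl⟩
  obtain ⟨C, hC, hx⟩ := exists_pgen_mul_mono R α β hA
  rw [← hx]
  exact Submodule.mul_mem_mul (h C hC) (mono_mem_comp R hm)

lemma pgen_mem_comp_nsmul {d : ℤ}
    (h : ∀ (A : Set V) (hA : G.InG0 A), pgen R G A hA ∈ comp R G d * comp R G (-d)) (n : ℕ)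
    (A : Set V) (hA : G.InG0 A) :
    pgen R G A hA ∈ comp R G (n * d) * comp R G (-(n * d)) := by
  induction n generalizing A with
  | zero =>
    rw [← pgen_mul_self]
    simpa using Submodule.mul_mem_mul (pgen_mem_comp R hA) (pgen_mem_comp R hA)
  | succ n ih =>
    have hle : comp R G d * comp R G (-d) ≤
        comp R G ((n + 1 : ℕ) * d) * comp R G (-((n + 1 : ℕ) * d)) :=
      calc comp R G d * comp R G (-d)
          ≤ comp R G d * (comp R G (n * d) * comp R G (-(n * d)) * comp R G (-d)) :=
            mul_le_mul' le_rfl (comp_le_mul_comp R ih _)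
        _ = (comp R G d * comp R G (n * d)) * (comp R G (-(n * d)) * comp R G (-d)) := by
            simp only [mul_assoc]
        _ ≤ comp R G (d + n * d) * comp R G (-(n * d) + -d) :=
            mul_le_mul' (comp_mul_comp_le R G _ _) (comp_mul_comp_le R G _ _)
        _ = _ := by congr 2 <;> push_cast <;> ring
    exact hle (h A hA)

/-- Strong grading follows once the local units lie in `L₁L₋₁` and in `L₋₁L₁`. -/
lemma comp_mul_comp_eq
    (h₁ : ∀ (A : Set V) (hA : G.InG0 A), pgen R G A hA ∈ comp R G 1 * comp R G (-1))
    (h₂ : ∀ (A : Set V) (hA : G.InG0 A), pgen R G A hA ∈ comp R G (-1) * comp R G 1)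
    (m n : ℤ) : comp R G m * comp R G n = comp R G (m + n) := by
  refine le_antisymm (comp_mul_comp_le R G m n) ?_
  have hm : ∀ (A : Set V) (hA : G.InG0 A), pgen R G A hA ∈ comp R G m * comp R G (-m) := by
    obtain ⟨k, rfl | rfl⟩ := m.eq_nat_or_neg
    · simpa using pgen_mem_comp_nsmul R h₁ k
    · simpa using pgen_mem_comp_nsmul R (d := -1) (by simpa using h₂) k
  calc comp R G (m + n) ≤ comp R G m * comp R G (-m) * comp R G (m + n) :=
        comp_le_mul_comp R hm _
    _ = comp R G m * (comp R G (-m) * comp R G (m + n)) := mul_assoc _ _ _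
    _ ≤ comp R G m * comp R G (-m + (m + n)) :=
        mul_le_mul' le_rfl (comp_mul_comp_le R G _ _)
    _ = comp R G m * comp R G n := by rw [neg_add_cancel_left]

end Grading

section Sufficiency

variable {V E : Type} (R : Type) [CommRing R] {G : Ultragraph V E}

lemma InG0.finite (hr : ∀ e : E, (G.rng e).Finite) {A : Set V} (hA : G.InG0 A) : A.Finite := by
  induction hA with
  | vertex v => exact Set.finite_singleton v
  | range e => exact hr e
  | union _ _ hA hB => exact hA.union hB
  | inter _ _ hA _ => exact hA.inter_of_left _

lemma pgen_mem_of_pvert_mem (M : Submodule R (LPABig R G)) {A : Set V} (hfin : A.Finite)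
    (hA : G.InG0 A) (h : ∀ v ∈ A, pvert R G v ∈ M) : pgen R G A hA ∈ M := by
  rcases A.eq_empty_or_nonempty with rfl | hne
  · rw [pgen_empty R G rfl]
    exact zero_mem _
  suffices H : ∃ hA' : G.InG0 A, pgen R G A hA' ∈ M from H.2
  clear hA
  induction A, hfin using Set.Finite.induction_on with
  | empty => exact absurd hne Set.not_nonempty_empty
  | @insert a s has _ ih =>
    rcases s.eq_empty_or_nonempty with rfl | hs
    · rw [insert_empty_eq]
      exact ⟨.vertex a, h a (by simp)⟩
    · obtain ⟨h0, h1⟩ := ih (fun v hv => h v (Set.mem_insert_of_mem a hv)) hs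
      rw [Set.insert_eq]
      refine ⟨(InG0.vertex a).union h0, ?_⟩
      rw [pgen_union R G (.vertex a) h0, pgen_empty R G (A := {a} ∩ s) (by simpa using has), sub_zero]
      exact add_mem (h a (by simp)) h1

lemma pvert_mem_comp_one_mul (hs : ∀ v : V, ∃ e : E, G.src e = v)
    (hf : ∀ v : V, {e : E | G.src e = v}.Finite) (v : V) :
    pvert R G v ∈ comp R G 1 * comp R G (-1) := by
  rw [pvert_eq_sum R G v (hf v) (hs v)]
  refine Submodule.sum_mem _ fun e _ => Submodule.mul_mem_mul ?_ ?_
  · rw [← sgen_mul_rng]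
    exact sgen_mul_mem_comp R e (pgen_mem_comp R _) (by norm_num)
  · rw [← tgen_mul_pvert]
    exact tgen_mul_mem_comp R e (pgen_mem_comp R _) (by norm_num)

lemma exists_extension_notMem (hs : ∀ v : V, ∃ e : E, G.src e = v)
    (hr : ∀ e : E, (G.rng e).Finite) (hf : ∀ v : V, {e : E | G.src e = v}.Finite)
    (M : Submodule R (LPABig R G)) {μ : List E} {w : V}
    (h : mono R G μ {w} (.vertex w) μ ∉ M) :
    ∃ (e : E) (u : V), G.src e = w ∧ u ∈ G.rng e ∧
      mono R G (μ ++ [e]) {u} (.vertex u) (μ ++ [e]) ∉ M := by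
  by_contra! hcon
  apply h
  have hsum := pvert_eq_sum R G w (hf w) (hs w)
  rw [pvert] at hsum
  rw [mono, hsum, Finset.mul_sum, Finset.sum_mul]
  refine Submodule.sum_mem _ fun e he => ?_
  have he' : G.src e = w := by simpa using he
  have := pgen_mem_of_pvert_mem R
    (M.comap (LinearMap.mulLeftRight R (sPath R G (μ ++ [e]), tPath R G (μ ++ [e]))))
    (hr e) (.range e) (fun u hu => by simpa [mono, pvert] using hcon e u he' hu)
  have hrw : sPath R G μ * (sgen R G e * tgen R G e) * tPath R G μ =
      sPath R G (μ ++ [e]) * pgen R G (G.rng e) (.range e) * tPath R G (μ ++ [e]) := by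
    conv_lhs => rw [← sgen_mul_rng]
    simp [mul_assoc]
  rw [hrw]
  simpa using this

lemma pvert_mem_comp_neg_one_mul (hs : ∀ v : V, ∃ e : E, G.src e = v)
    (hr : ∀ e : E, (G.rng e).Finite) (hf : ∀ v : V, {e : E | G.src e = v}.Finite)
    (hY : G.ConditionY) (v : V) :
    pvert R G v ∈ comp R G (-1) * comp R G 1 := by
  by_contra hv
  set M := comp R G (-1) * comp R G 1 with hM
  let S := {q : List E × V // mono R G q.1 {q.2} (.vertex q.2) q.1 ∉ M}
  have step : ∀ q : S, ∃ (e : E) (q' : S), G.src e = q.1.2 ∧ q'.1.2 ∈ G.rng e ∧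
      q'.1.1 = q.1.1 ++ [e] := by
    rintro ⟨⟨μ, w⟩, h⟩
    obtain ⟨e, u, h1, h2, h3⟩ := exists_extension_notMem R hs hr hf M h
    exact ⟨e, ⟨(μ ++ [e], u), h3⟩, h1, h2, rfl⟩
  choose edge next h1 h2 h3 using step
  let q : ℕ → S := fun n => next^[n] ⟨([], v), by simpa [mono, pvert] using hv⟩
  have hq : ∀ n, q (n + 1) = next (q n) := fun n => Function.iterate_succ_apply' _ _ _
  have hlen : ∀ n, (q n).1.1.length = n := by
    intro n
    induction n with
    | zero => rfl
    | succ n ih => rw [hq, h3, List.length_append, ih, List.length_singleton]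
  have hpath : G.IsInfinitePath (fun n => edge (q n)) := by
    intro i
    rw [h1, hq]
    exact h2 (q i)
  obtain ⟨k, α, hα, hk, hp, hw⟩ := hY _ hpath
  rw [h1] at hw
  apply (q k).2
  set μ := (q k).1.1 with hμ
  set w := (q k).1.2
  have hμk : μ.length = k := hlen k
  have : mono R G μ {w} (.vertex w) μ =
      mono R G μ {w} (.vertex w) α * mono R G α {w} (.vertex w) μ := by
    have := pvert_mul_tPath_mul_sPath R hα hp hw
    calc mono R G μ {w} (.vertex w) μ
        = sPath R G μ * (pvert R G w * tPath R G α * (sPath R G α * pvert R G w)) *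
            tPath R G μ := by rw [this]; rfl
      _ = _ := by simp only [mono, mul_assoc]; rfl
  rw [this]
  exact Submodule.mul_mem_mul (mono_mem_comp R (by lia)) (mono_mem_comp R (by lia))

end Sufficiency

section Nonvanishing

/-- A countable infinite branching system for `G` over `V × ℕ`: `D` splits off the first edge
and `ψ` prepends an edge. -/
lemma exists_branching {V E : Type} [Countable V] [Countable E] (G : Ultragraph V E) :
    ∃ (D : V × ℕ → Option (E × (V × ℕ))) (ψ : E → V × ℕ → V × ℕ),
      (∀ y e x, D y = some (e, x) → G.src e = y.1 ∧ x.1 ∈ G.rng e ∧ ψ e x = y) ∧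
      (∀ e x, x.1 ∈ G.rng e → D (ψ e x) = some (e, x)) ∧
      (∀ y, (∃ e, G.src e = y.1) → ∃ e x, D y = some (e, x)) := by
  classical
  let Y : V → Type := fun v => {z : E × (V × ℕ) // G.src z.1 = v ∧ z.2.1 ∈ G.rng z.1}
  have hY : ∀ v, (∃ e, G.src e = v) → Nonempty (ℕ ≃ Y v) := by
    rintro v ⟨e, he⟩
    obtain ⟨w, hw⟩ := G.rng_nonempty e
    have : Infinite (Y v) :=
      Infinite.of_injective (fun n : ℕ => (⟨(e, (w, n)), he, hw⟩ : Y v)) fun a b h => by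
        simpa using congrArg (fun z : Y v => z.1.2.2) h
    exact nonempty_equiv_of_countable
  let f : ∀ v, (∃ e, G.src e = v) → ℕ ≃ Y v := fun v h => (hY v h).some
  refine ⟨fun y => if h : ∃ e, G.src e = y.1 then some (f y.1 h y.2).1 else none,
    fun e x => if hx : x.1 ∈ G.rng e then
      (G.src e, (f (G.src e) ⟨e, rfl⟩).symm ⟨(e, x), rfl, hx⟩) else x, ?_, ?_, ?_⟩
  · rintro ⟨v, n⟩ e x hD
    by_cases h : ∃ e, G.src e = v
    · simp only [h, dite_true, Option.some.injEq] at hD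
      have hp := (f v h n).2
      rw [hD] at hp
      obtain ⟨rfl, hx⟩ := hp
      refine ⟨rfl, hx, ?_⟩
      have : (⟨(e, x), rfl, hx⟩ : Y (G.src e)) = f (G.src e) h n := Subtype.ext hD.symm
      simp only at hx
      simp [hx, this]
    · simp [h] at hD
  · intro e x hx
    beta_reduce
    rw [dif_pos hx, dif_pos ⟨e, rfl⟩, Equiv.apply_symm_apply]
  · intro y h
    exact ⟨_, _, by simp only [h, dite_true]; rfl⟩

variable {V E : Type} (R : Type) [CommRing R] (G : Ultragraph V E)

/-- The operators on functions `V × ℕ → R` attached to the generators by a branching system. -/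
noncomputable def branchingOp (D : V × ℕ → Option (E × (V × ℕ))) (ψ : E → V × ℕ → V × ℕ) :
    LPAGen G → Module.End R (V × ℕ → R) := by
  classical exact fun g => match g with
  | .edge e =>
    { toFun := fun f y => (D y).elim 0 fun z => if z.1 = e then f z.2 else 0
      map_add' := fun f g => by
        funext y
        rcases h : D y with _ | z
        · simp [h]
        · by_cases hz : z.1 = e <;> simp [h, hz]
      map_smul' := fun a f => by
        funext y
        rcases h : D y with _ | z
        · simp [h]
        · by_cases hz : z.1 = e <;> simp [h, hz] }
  | .star e =>
    { toFun := fun f x => if x.1 ∈ G.rng e then f (ψ e x) else 0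
      map_add' := fun f g => by
        funext x
        by_cases hx : x.1 ∈ G.rng e <;> simp [hx]
      map_smul' := fun a f => by
        funext x
        by_cases hx : x.1 ∈ G.rng e <;> simp [hx] }
  | .proj A _ =>
    { toFun := fun f x => if x.1 ∈ A then f x else 0
      map_add' := fun f g => by
        funext x
        by_cases hx : x.1 ∈ A <;> simp [hx]
      map_smul' := fun a f => by
        funext x
        by_cases hx : x.1 ∈ A <;> simp [hx] }

section

variable {G} {D : V × ℕ → Option (E × (V × ℕ))} {ψ : E → V × ℕ → V × ℕ}

open Classical in
lemma branchingOp_edge_apply (e : E) (f : V × ℕ → R) (y : V × ℕ) :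
    branchingOp R G D ψ (.edge e) f y =
      (D y).elim 0 fun z => if z.1 = e then f z.2 else 0 := rfl

open Classical in
lemma branchingOp_star_apply (e : E) (f : V × ℕ → R) (x : V × ℕ) :
    branchingOp R G D ψ (.star e) f x = if x.1 ∈ G.rng e then f (ψ e x) else 0 := rfl

open Classical in
lemma branchingOp_proj_apply (A : Set V) (hA : G.InG0 A) (f : V × ℕ → R) (x : V × ℕ) :
    branchingOp R G D ψ (.proj A hA) f x = if x.1 ∈ A then f x else 0 := rfl

lemma branchingOp_rel
    (hD : ∀ y e x, D y = some (e, x) → G.src e = y.1 ∧ x.1 ∈ G.rng e ∧ ψ e x = y)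
    (hψ : ∀ e x, x.1 ∈ G.rng e → D (ψ e x) = some (e, x))
    (hex : ∀ y, (∃ e, G.src e = y.1) → ∃ e x, D y = some (e, x)) ⦃a b : FA R G⦄
    (h : LeavittRel R G a b) :
    FreeAlgebra.lift R (branchingOp R G D ψ) a = FreeAlgebra.lift R (branchingOp R G D ψ) b := by
  classical
  cases h with
  | proj_empty h =>
    refine LinearMap.ext fun f => funext fun x => ?_
    simp [X, branchingOp_proj_apply]
  | proj_mul A B hA hB =>
    refine LinearMap.ext fun f => funext fun x => ?_
    by_cases h1 : x.1 ∈ A <;> by_cases h2 : x.1 ∈ B <;>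
      simp [X, branchingOp_proj_apply, h1, h2]
  | proj_union A B hA hB =>
    refine LinearMap.ext fun f => funext fun x => ?_
    by_cases h1 : x.1 ∈ A <;> by_cases h2 : x.1 ∈ B <;>
      simp [X, branchingOp_proj_apply, h1, h2]
  | src_mul e =>
    refine LinearMap.ext fun f => funext fun y => ?_
    rcases h : D y with _ | ⟨e', x⟩
    · simp [X, branchingOp_proj_apply, branchingOp_edge_apply, h]
    · have := (hD y e' x h).1
      by_cases he : e' = e
      · subst he
        simp [X, branchingOp_proj_apply, branchingOp_edge_apply, h, this]
      · simp [X, branchingOp_proj_apply, branchingOp_edge_apply, h, he]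
  | mul_rng e =>
    refine LinearMap.ext fun f => funext fun y => ?_
    rcases h : D y with _ | ⟨e', x⟩
    · simp [X, branchingOp_edge_apply, h]
    · have := (hD y e' x h).2.1
      by_cases he : e' = e
      · subst he
        simp [X, branchingOp_proj_apply, branchingOp_edge_apply, h, this]
      · simp [X, branchingOp_edge_apply, h, he]
  | rng_mul_star e =>
    refine LinearMap.ext fun f => funext fun x => ?_
    by_cases h : x.1 ∈ G.rng e <;>
      simp [X, branchingOp_proj_apply, branchingOp_star_apply, h]
  | star_mul_src e =>
    refine LinearMap.ext fun f => funext fun x => ?_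
    by_cases h : x.1 ∈ G.rng e
    · have := (hD _ _ _ (hψ e x h)).1
      simp [X, branchingOp_proj_apply, branchingOp_star_apply, h, this]
    · simp [X, branchingOp_star_apply, h]
  | star_mul_same e =>
    refine LinearMap.ext fun f => funext fun x => ?_
    by_cases h : x.1 ∈ G.rng e
    · simp [X, branchingOp_proj_apply, branchingOp_star_apply, branchingOp_edge_apply, h, hψ e x h]
    · simp [X, branchingOp_proj_apply, branchingOp_star_apply, h]
  | star_mul_ne e e' hne =>
    refine LinearMap.ext fun f => funext fun x => ?_
    by_cases h : x.1 ∈ G.rng e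
    · simp [X, branchingOp_star_apply, branchingOp_edge_apply, h, hψ e x h, hne]
    · simp [X, branchingOp_star_apply, h]
  | ck v hfin hne =>
    refine LinearMap.ext fun f => funext fun y => ?_
    simp only [X, map_sum, map_mul, FreeAlgebra.lift_ι_apply, LinearMap.sum_apply,
      Finset.sum_apply, Module.End.mul_apply, branchingOp_proj_apply, branchingOp_edge_apply]
    rcases h : D y with _ | ⟨e', x⟩
    · have hy : y.1 ≠ v := by
        rintro rfl
        obtain ⟨e, x, h'⟩ := hex y hne
        simp [h] at h'
      simp [hy]
    · obtain ⟨h1, h2, h3⟩ := hD y e' x h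
      simp [branchingOp_star_apply, h1, h2, h3]

end

theorem pvert_ne_zero [Countable V] [Countable E] [Nontrivial R] (v : V) :
    pvert R G v ≠ 0 := by
  obtain ⟨D, ψ, hD, hψ, hex⟩ := exists_branching G
  intro h0
  let Φ : LPABig R G →ₐ[R] Module.End R (V × ℕ → R) :=
    RingQuot.liftAlgHom R ⟨FreeAlgebra.lift R (branchingOp R G D ψ), branchingOp_rel R hD hψ hex⟩
  have h1 : Φ (pvert R G v) = branchingOp R G D ψ (.proj {v} (.vertex v)) := by
    simp [Φ, pvert, pgen, gen, X]
  have h2 := congrFun (LinearMap.congr_fun h1 (fun _ => 1)) (v, 0)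
  rw [h0, map_zero, branchingOp_proj_apply] at h2
  simp at h2

end Nonvanishing

section Necessity

variable {V E : Type} (R : Type) [CommRing R] {G : Ultragraph V E}

/-- An element of `L₁L₋₁` is annihilated on the left by all but finitely many ghost edges, and by
the vertices that are not sources of those finitely many edges. -/
lemma exists_finset_annihilates {x : LPABig R G} (hx : x ∈ comp R G 1 * comp R G (-1)) :
    ∃ F : Finset E, (∀ e ∉ F, tgen R G e * x = 0) ∧
      ∀ w, (∀ e ∈ F, G.src e ≠ w) → pvert R G w * x = 0 := by
  classical
  have hadd : ∀ x y : LPABig R G,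
      (∃ F : Finset E, (∀ e ∉ F, tgen R G e * x = 0) ∧
        ∀ w, (∀ e ∈ F, G.src e ≠ w) → pvert R G w * x = 0) →
      (∃ F : Finset E, (∀ e ∉ F, tgen R G e * y = 0) ∧
        ∀ w, (∀ e ∈ F, G.src e ≠ w) → pvert R G w * y = 0) →
      ∃ F : Finset E, (∀ e ∉ F, tgen R G e * (x + y) = 0) ∧
        ∀ w, (∀ e ∈ F, G.src e ≠ w) → pvert R G w * (x + y) = 0 := by
    rintro x y ⟨F, hF, hF'⟩ ⟨F₂, hF₂, hF₂'⟩
    refine ⟨F ∪ F₂, fun e he => ?_, fun w hw => ?_⟩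
    · rw [Finset.mem_union, not_or] at he
      rw [mul_add, hF e he.1, hF₂ e he.2, add_zero]
    · rw [mul_add, hF' w fun e he => hw e (Finset.mem_union_left _ he),
        hF₂' w fun e he => hw e (Finset.mem_union_right _ he), add_zero]
  induction hx using Submodule.mul_induction_on' with
  | add x _ y _ ihx ihy => exact hadd x y ihx ihy
  | mem_mul_mem a ha b hb =>
    suffices H : ∃ F : Finset E, (∀ e ∉ F, tgen R G e * a = 0) ∧
        ∀ w, (∀ e ∈ F, G.src e ≠ w) → pvert R G w * a = 0 by
      obtain ⟨F, h1, h2⟩ := H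
      exact ⟨F, fun e he => by rw [← mul_assoc, h1 e he, zero_mul],
        fun w hw => by rw [← mul_assoc, h2 w hw, zero_mul]⟩
    clear hb
    induction ha using Submodule.span_induction with
    | mem x hx =>
      obtain ⟨α, β, A, hA, hm, rfl⟩ := hx
      cases α with
      | nil => rw [List.length_nil] at hm; lia
      | cons a α =>
        refine ⟨{a}, fun e he => ?_, fun w hw => ?_⟩
        · simp [mono, ← mul_assoc, tgen_mul_sgen_ne R G (Finset.notMem_singleton.1 he)]
        · have : pvert R G w * sgen R G a = 0 :=
            pgen_mul_sgen_of_notMem R _ (hw a (by simp))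
          simp [mono, ← mul_assoc, this]
    | zero => exact ⟨∅, by simp⟩
    | add x y _ _ ihx ihy => exact hadd x y ihx ihy
    | smul c x _ ih =>
      obtain ⟨F, h1, h2⟩ := ih
      exact ⟨F, fun e he => by rw [mul_smul_comm, h1 e he, smul_zero],
        fun w hw => by rw [mul_smul_comm, h2 w hw, smul_zero]⟩

lemma tgen_ne_zero [Countable V] [Countable E] [Nontrivial R] (e : E) : tgen R G e ≠ 0 := by
  intro h
  obtain ⟨w, hw⟩ := G.rng_nonempty e
  apply pvert_ne_zero R G w
  rw [← pvert_mul_pgen_of_mem R (.range e) hw, ← tgen_mul_sgen_self, h, zero_mul, mul_zero]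

/-- The prefix of length `n` of an infinite sequence of edges. -/
def initialSegment (p : ℕ → E) : ℕ → List E
  | 0 => []
  | n + 1 => initialSegment p n ++ [p n]

lemma length_initialSegment (p : ℕ → E) (n : ℕ) : (initialSegment p n).length = n := by
  induction n with
  | zero => rfl
  | succ n ih => rw [initialSegment, List.length_append, ih, List.length_singleton]

lemma pvert_mul_initialSegment {p : ℕ → E} (hp : G.IsInfinitePath p) (n : ℕ) :
    pvert R G (G.src (p n)) * tPath R G (initialSegment p n) * pvert R G (G.src (p 0)) *
      (sPath R G (initialSegment p n) * pvert R G (G.src (p n))) = pvert R G (G.src (p n)) := by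
  induction n with
  | zero => simp [initialSegment, pvert_mul_self]
  | succ n ih =>
    calc _ = pvert R G (G.src (p (n + 1))) * (tgen R G (p n) * (pvert R G (G.src (p n)) *
            tPath R G (initialSegment p n) * pvert R G (G.src (p 0)) *
            (sPath R G (initialSegment p n) * pvert R G (G.src (p n)))) * sgen R G (p n)) *
            pvert R G (G.src (p (n + 1))) := by
          simp only [initialSegment, tPath_append, sPath_append, tPath_cons, tPath_nil, sPath_cons,
            sPath_nil, one_mul, mul_one]
          conv_lhs => rw [← tgen_mul_pvert, ← pvert_mul_sgen]
          simp only [mul_assoc]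
      _ = _ := by
          rw [ih, tgen_mul_pvert, tgen_mul_sgen_self, pvert_mul_pgen_of_mem R _ (hp n),
            pvert_mul_self]

/-- If Condition (Y) fails along `p`, then every element of `L₋₁L₁` is annihilated by the ghost
paths of long enough initial segments of `p`. -/
lemma exists_annihilated {p : ℕ → E}
    (hp : ∀ (k : ℕ) (α : List E) (hα : α ≠ []), α.length = k + 1 → G.IsPath α →
      G.src (p k) ∉ G.rng (α.getLast hα))
    {x : LPABig R G} (hx : x ∈ comp R G (-1) * comp R G 1) :
    ∃ N, ∀ k ≥ N, pvert R G (G.src (p k)) * tPath R G (initialSegment p k) * x = 0 := by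
  have hadd : ∀ x y : LPABig R G,
      (∃ N, ∀ k ≥ N, pvert R G (G.src (p k)) * tPath R G (initialSegment p k) * x = 0) →
      (∃ N, ∀ k ≥ N, pvert R G (G.src (p k)) * tPath R G (initialSegment p k) * y = 0) →
      ∃ N, ∀ k ≥ N, pvert R G (G.src (p k)) * tPath R G (initialSegment p k) * (x + y) = 0 := by
    rintro x y ⟨N, hN⟩ ⟨N', hN'⟩
    refine ⟨max N N', fun k hk => ?_⟩
    rw [mul_add, hN k (le_of_max_le_left hk), hN' k (le_of_max_le_right hk), add_zero]
  induction hx using Submodule.mul_induction_on' with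
  | add x _ y _ ihx ihy => exact hadd x y ihx ihy
  | mem_mul_mem a ha b hb =>
    suffices H : ∃ N, ∀ k ≥ N,
        pvert R G (G.src (p k)) * tPath R G (initialSegment p k) * a = 0 by
      obtain ⟨N, hN⟩ := H
      exact ⟨N, fun k hk => by rw [← mul_assoc, hN k hk, zero_mul]⟩
    clear hb
    induction ha using Submodule.span_induction with
    | mem x hx =>
      obtain ⟨α, β, A, hA, hm, rfl⟩ := hx
      refine ⟨α.length, fun k hk => ?_⟩
      rw [mono, mul_assoc (sPath R G α)]
      refine pvert_mul_tPath_mul_sPath_mul_eq_zero R α _ (by rwa [length_initialSegment]) ?_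
      intro n hn
      rw [length_initialSegment] at hn
      have hlen : (β ++ n).length = k + 1 := by rw [List.length_append]; lia
      have hne : β ++ n ≠ [] := List.ne_nil_of_length_eq_add_one hlen
      have hz : pvert R G (G.src (p k)) * tPath R G n * tPath R G β = 0 := by
        rw [mul_assoc, ← tPath_append]
        exact pvert_mul_tPath_eq_zero R hne (hp k _ hne hlen)
      rw [← mul_assoc]
      rcases pvert_mul_tPath_mul_pgen R (G.src (p k)) n hA with h | h
      · rw [h, hz]
      · rw [h, zero_mul]
    | zero => exact ⟨0, by simp⟩
    | add x y _ _ ihx ihy => exact hadd x y ihx ihy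
    | smul c x _ ih =>
      obtain ⟨N, hN⟩ := ih
      exact ⟨N, fun k hk => by rw [mul_smul_comm, hN k hk, smul_zero]⟩

end Necessity

end Ultragraph

open Ultragraph in
/-- `L_R(𝒢)` is strongly `ℤ`-graded iff `𝒢` has no sinks, is row-finite
and satisfies Condition (Y). -/
theorem stronglyZGraded_iff {V E : Type} [Countable V] [Countable E]
    (G : Ultragraph V E) (R : Type) [CommRing R] [Nontrivial R] :
    (∀ m n : ℤ, mulSpan (zComp R G m) (zComp R G n) = zComp R G (m + n)) ↔
      ((∀ v : V, ∃ e : E, G.src e = v) ∧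
        ((∀ e : E, (G.rng e).Finite) ∧ (∀ v : V, {e : E | G.src e = v}.Finite)) ∧
        G.ConditionY) := by
  simp only [mulSpan_zComp_eq_iff]
  constructor
  · intro h
    have hpos : ∀ (A : Set V) (hA : G.InG0 A), pgen R G A hA ∈ comp R G 1 * comp R G (-1) := by
      intro A hA
      rw [h]
      exact pgen_mem_comp R hA
    refine ⟨fun v => ?_, ⟨fun e => ?_, fun v => ?_⟩, fun p hp => ?_⟩
    · by_contra! hv
      obtain ⟨F, -, hF⟩ := exists_finset_annihilates R (hpos _ (.vertex v))
      apply pvert_ne_zero R G v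
      rw [← pvert_mul_self]
      exact hF v fun e _ => hv e
    · obtain ⟨F, -, hF⟩ := exists_finset_annihilates R (hpos _ (.range e))
      refine (F.finite_toSet.image G.src).subset fun w hw => ?_
      by_contra hwF
      apply pvert_ne_zero R G w
      rw [← pvert_mul_pgen_of_mem R (.range e) hw]
      exact hF w fun e' he' hsrc => hwF ⟨e', he', hsrc⟩
    · obtain ⟨F, hF, -⟩ := exists_finset_annihilates R (hpos _ (.vertex v))
      refine F.finite_toSet.subset fun e he => ?_
      by_contra heF
      apply tgen_ne_zero R (G := G) e
      rw [← tgen_mul_pgen_of_mem R (.vertex v) he]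
      exact hF e heF
    · by_contra! hcon
      have hmem : pvert R G (G.src (p 0)) ∈ comp R G (-1) * comp R G 1 := by
        rw [h]
        exact pgen_mem_comp R _
      obtain ⟨N, hN⟩ := exists_annihilated R hcon hmem
      apply pvert_ne_zero R G (G.src (p N))
      rw [← pvert_mul_initialSegment R hp N, hN N le_rfl, zero_mul]
  · rintro ⟨hs, ⟨hr, hf⟩, hY⟩
    refine comp_mul_comp_eq R (fun A hA => ?_) (fun A hA => ?_)
    · exact pgen_mem_of_pvert_mem R _ (hA.finite hr) hA fun v _ =>
        pvert_mem_comp_one_mul R hs hf v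
    · exact pgen_mem_of_pvert_mem R _ (hA.finite hr) hA fun v _ =>
        pvert_mem_comp_neg_one_mul R hs hr hf hY v
end
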